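/- arXiv:1210.2528 — 2 statements merged into one kernel-verified Lean document; each statement's English description precedes it below -/
import Mathlib

section
/- Let B be a finite dimensional Lie algebra over a field F of characteristic 0 with an action of a Lie algebra 𝔤 by derivations. If B is 𝔤-simple (nonabelian and with no proper nonzero 𝔤-invariant ideals), then B is a simple Lie algebra. -/
/-- A finite dimensional Lie algebra `B` over a field of characteristic `0`
with an action of a Lie algebra `𝔤` by derivations which is `𝔤`-simple (nonabelian and
with no proper nonzero `𝔤`-invariant ideals) is a simple Lie algebra. -/
theorem lie_simple_of_gSimple
    (F : Type*) [Field F] [CharZero F]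
    (B : Type*) [LieRing B] [LieAlgebra F B] [Module.Finite F B]
    (𝔤 : Type*) [LieRing 𝔤] [LieAlgebra F 𝔤]
    -- `𝔤` acts on `B` by derivations
    (ρ : 𝔤 →ₗ⁅F⁆ LieDerivation F B B)
    -- `B` is `𝔤`-simple: nonabelian with no proper nonzero `𝔤`-invariant ideals
    (hnonab : ∃ a b : B, ⁅a, b⁆ ≠ 0)
    (hgsimple : ∀ I : LieIdeal F B,
      (∀ x : 𝔤, ∀ a ∈ I, ρ x a ∈ I) → I = ⊥ ∨ I = ⊤) :
    LieAlgebra.IsSimple F B := by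
  have inv : ∀ (D : LieDerivation F B B) (x y : B),
      killingForm F B y (D x) = - killingForm F B (D y) x := by
    intro D x y
    have h : ∀ z : B, LieAlgebra.ad F B (D z) =
        (D : B →ₗ[F] B) * LieAlgebra.ad F B z - LieAlgebra.ad F B z * (D : B →ₗ[F] B) := by
      intro z
      ext w
      simp [LieDerivation.apply_lie_eq_sub]
      try rw [← lie_skew w (D z), sub_neg_eq_add, add_sub_cancel_left]
    rw [killingForm_apply_apply, killingForm_apply_apply, h, h, ← Module.End.mul_eq_comp,
      ← Module.End.mul_eq_comp, mul_sub, sub_mul, map_sub, map_sub, ← mul_assoc, ← mul_assoc,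
      LinearMap.trace_mul_comm F (LieAlgebra.ad F B y * LieAlgebra.ad F B x) (D : B →ₗ[F] B),
      ← mul_assoc]
    ring
  have hna : ¬ IsLieAbelian B := by
    intro h
    obtain ⟨a, b, hab⟩ := hnonab
    exact hab (h.trivial a b)
  have hperf : ⁅(⊤ : LieIdeal F B), (⊤ : LieIdeal F B)⁆ = ⊤ := by
    refine (hgsimple _ ?_).resolve_left ?_
    · intro x a ha
      have hle : (⁅(⊤ : LieIdeal F B), (⊤ : LieIdeal F B)⁆).toSubmodule ≤
          (⁅(⊤ : LieIdeal F B), (⊤ : LieIdeal F B)⁆).toSubmodule.comap (ρ x : B →ₗ[F] B) := by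
        conv_lhs => rw [LieSubmodule.lieIdeal_oper_eq_linear_span']
        rw [Submodule.span_le]
        rintro _ ⟨u, -, v, -, rfl⟩
        change ρ x ⁅u, v⁆ ∈ ⁅(⊤ : LieIdeal F B), (⊤ : LieIdeal F B)⁆
        rw [LieDerivation.apply_lie_eq_add]
        exact add_mem (LieSubmodule.lie_mem_lie (LieSubmodule.mem_top _) (LieSubmodule.mem_top _))
          (LieSubmodule.lie_mem_lie (LieSubmodule.mem_top _) (LieSubmodule.mem_top _))
      exact hle ha
    · intro h
      obtain ⟨a, b, hab⟩ := hnonab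
      apply hab
      rw [← LieSubmodule.mem_bot (R := F) (L := B), ← h]
      exact LieSubmodule.lie_mem_lie (LieSubmodule.mem_top _) (LieSubmodule.mem_top _)
  have hK : LieIdeal.killingCompl F B ⊤ = ⊥ := by
    refine (hgsimple _ ?_).resolve_right ?_
    · intro x a ha
      rw [LieIdeal.mem_killingCompl] at ha ⊢
      intro y _
      rw [inv, ha _ (LieSubmodule.mem_top _), neg_zero]
    · intro h
      have hs : LieAlgebra.IsSolvable B := by
        apply LieAlgebra.isSolvable_of_killingForm_apply_lie_eq_zero (R := F)
        intro x y _
        have hy : y ∈ LieIdeal.killingCompl F B ⊤ := by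
          rw [h]; exact LieSubmodule.mem_top y
        exact (LieIdeal.mem_killingCompl F B ⊤).mp hy x (LieSubmodule.mem_top x)
      obtain ⟨k, hk⟩ := hs.solvable F
      have ht : ∀ k, LieAlgebra.derivedSeries F B k = ⊤ := by
        intro k
        induction k with
        | zero => rfl
        | succ n ih =>
          rw [LieAlgebra.derivedSeries_def] at ih ⊢
          rw [LieAlgebra.derivedSeriesOfIdeal_succ, ih, hperf]
      obtain ⟨a, b, hab⟩ := hnonab
      apply hab
      rw [← LieSubmodule.mem_bot (R := F) (L := B), ← hk, ht]
      exact LieSubmodule.mem_top _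
  have hkill : LieAlgebra.IsKilling F B := ⟨hK⟩
  refine ⟨fun I => hgsimple I ?_, hna⟩
  intro x a ha
  obtain ⟨z, hz⟩ := LieDerivation.IsKilling.exists_eq_ad (ρ x)
  rw [← hz, LieDerivation.ad_apply_apply]
  exact I.lie_mem ha
end

section
/- Let L be a finite dimensional Lie algebra over an algebraically closed field F of characteristic 0 and let 𝔤 be a finite dimensional semisimple Lie algebra acting on L by derivations. Then there exists a maximal semisimple subalgebra B ⊆ L such that L = B ⊕ R as a direct sum of 𝔤-submodules, where R is the solvable radical of L. -/
set_option linter.unusedSectionVars false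

namespace GLevi
open LieAlgebra Module

variable {F : Type*} [Field F] [CharZero F]

/-- Extensions of solvable by solvable are solvable. -/
lemma isSolvable_of_ker {L L' : Type*} [LieRing L] [LieAlgebra F L] [LieRing L'] [LieAlgebra F L']
    (f : L →ₗ⁅F⁆ L') [IsSolvable L'] [IsSolvable f.ker] : IsSolvable L := by
  obtain ⟨k, hk⟩ := IsSolvable.solvable F L'
  obtain ⟨m, hm⟩ := IsSolvable.solvable F f.ker
  rw [LieIdeal.derivedSeries_eq_bot_iff] at hm
  have h1 : derivedSeries F L k ≤ f.ker := by
    have := LieIdeal.derivedSeries_map_le (f := f) k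
    rw [hk, le_bot_iff, LieIdeal.map_eq_bot_iff] at this
    exact this
  refine IsSolvable.mk (R := F) (k := m + k) ?_
  rw [derivedSeries_def, derivedSeriesOfIdeal_add, eq_bot_iff, ← hm]
  exact derivedSeriesOfIdeal_mono h1 m

/-- Restriction of a hom to the preimage of an ideal. -/
def comapHom {L L' : Type*} [LieRing L] [LieAlgebra F L] [LieRing L'] [LieAlgebra F L']
    (f : L →ₗ⁅F⁆ L') (K : LieSubalgebra F L) (J : LieSubalgebra F L')
    (h : ∀ x ∈ K, f x ∈ J) : K →ₗ⁅F⁆ J where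
  toFun x := ⟨f x, h x x.2⟩
  map_add' x y := by ext; simp
  map_smul' t x := by ext; simp
  map_lie' {x y} := by ext; simp

@[simp] lemma coe_comapHom {L L' : Type*} [LieRing L] [LieAlgebra F L] [LieRing L'] [LieAlgebra F L']
    (f : L →ₗ⁅F⁆ L') (K : LieSubalgebra F L) (J : LieSubalgebra F L')
    (h : ∀ x ∈ K, f x ∈ J) (x : K) : (comapHom f K J h x : L') = f x := rfl

lemma solvable_comap {L L' : Type*} [LieRing L] [LieAlgebra F L] [LieRing L'] [LieAlgebra F L']
    (f : L →ₗ⁅F⁆ L') [hk : IsSolvable f.ker] (K : LieSubalgebra F L) (J : LieSubalgebra F L')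
    [hJ : IsSolvable J] (h : ∀ x ∈ K, f x ∈ J) : IsSolvable K := by
  have : IsSolvable (comapHom f K J h).ker := by
    let g : (comapHom f K J h).ker →ₗ⁅F⁆ f.ker :=
      { toFun := fun x => ⟨x.1.1, by
          have := x.2
          rw [LieHom.mem_ker] at this ⊢
          simpa using congrArg Subtype.val this⟩
        map_add' := fun x y => rfl
        map_smul' := fun t x => rfl
        map_lie' := fun {x y} => rfl }
    have hg : Function.Injective g := fun x y hxy => by
      ext; exact congrArg (fun z => (z.1 : L)) hxy
    exact hg.lieAlgebra_isSolvable
  exact isSolvable_of_ker (comapHom f K J h)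

/-- The quotient by the radical has trivial radical. -/
lemma hasTrivialRadical_quot {L : Type*} [LieRing L] [LieAlgebra F L] [Module.Finite F L] :
    HasTrivialRadical F (L ⧸ radical F L) := by
  apply hasTrivialRadical_of_no_solvable_ideals
  intro J hJ
  let f : L →ₗ⁅F⁆ L ⧸ radical F L :=
    { (LieSubmodule.Quotient.mk' (radical F L) : L →ₗ[F] L ⧸ radical F L) with
      map_lie' := fun {x y} => rfl }
  have hf : f.ker = radical F L := by
    ext x
    rw [LieHom.mem_ker]
    exact LieSubmodule.Quotient.mk_eq_zero' 
  have : IsSolvable f.ker := by rw [hf]; infer_instance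
  have hJ' : IsSolvable J.toLieSubalgebra := hJ
  have hK : IsSolvable (LieIdeal.comap f J) :=
    solvable_comap f (LieIdeal.comap f J).toLieSubalgebra J.toLieSubalgebra (fun x hx => by
      simpa using hx)
  rw [LieIdeal.solvable_iff_le_radical] at hK
  rw [LieSubmodule.eq_bot_iff]
  intro x hx
  obtain ⟨y, rfl⟩ := LieSubmodule.Quotient.surjective_mk' (radical F L) x
  rw [LieSubmodule.Quotient.mk_eq_zero]
  apply hK
  rw [LieIdeal.mem_comap]; exact hx

/-- surjective images of semisimple are semisimple -/
lemma hasTrivialRadical_of_surjective {Q S : Type*} [LieRing Q] [LieAlgebra F Q]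
    [LieRing S] [LieAlgebra F S] [Module.Finite F Q] [HasTrivialRadical F Q]
    (f : Q →ₗ⁅F⁆ S) (hf : Function.Surjective f) : HasTrivialRadical F S := by
  apply hasTrivialRadical_of_no_solvable_ideals
  intro J hJ
  have hc := f.ker.isCompl_killingCompl
  set I' := LieIdeal.killingCompl F Q f.ker
  let K : LieIdeal F Q := LieIdeal.comap f J ⊓ I'
  have hK : IsSolvable K := by
    have hinj : Function.Injective (comapHom f K.toLieSubalgebra J.toLieSubalgebra
      (fun x hx => by simpa using hx.1)) := by
      rw [← LieHom.ker_eq_bot, LieSubmodule.eq_bot_iff]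
      intro x hx
      rw [LieHom.mem_ker] at hx
      have h1 : x.1 ∈ f.ker := by simpa using congrArg Subtype.val hx
      have h2 : x.1 ∈ I' := x.2.2
      have : x.1 ∈ f.ker ⊓ I' := ⟨h1, h2⟩
      rw [hc.inf_eq_bot] at this
      ext; simpa using this
    have hJ' : IsSolvable J.toLieSubalgebra := hJ
    exact hinj.lieAlgebra_isSolvable
  have hK0 : K = ⊥ := HasTrivialRadical.eq_bot_of_isSolvable K
  rw [LieSubmodule.eq_bot_iff]
  intro y hy
  obtain ⟨x, rfl⟩ := hf y
  have hx : x ∈ f.ker ⊔ I' := by rw [hc.sup_eq_top]; trivial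
  obtain ⟨a, ha, b, hb, rfl⟩ := (LieSubmodule.mem_sup _ _ _).1 hx
  rw [LieHom.mem_ker] at ha
  rw [map_add, ha, zero_add] at hy ⊢
  have : b ∈ K := ⟨by simpa using hy, hb⟩
  rw [hK0] at this
  simp at this
  simp [this]

/-- ideals of semisimple are semisimple -/
lemma hasTrivialRadical_ideal {Q : Type*} [LieRing Q] [LieAlgebra F Q]
    [Module.Finite F Q] [HasTrivialRadical F Q] (I : LieIdeal F Q) : HasTrivialRadical F I := by
  rw [hasTrivialRadical_iff_no_abelian_ideals]
  intro J hJ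
  have hc := I.isCompl_killingCompl
  rw [LieSubmodule.eq_bot_iff]
  intro x hx
  have h1 : ∀ y : I, killingForm F Q y.1 x.1 = 0 := by
    intro y
    have := LieIdeal.le_killingCompl_top_of_isLieAbelian F I J hx
    rw [LieIdeal.mem_killingCompl] at this
    have := this y trivial
    rw [LieIdeal.killingForm_eq] at this
    exact this
  have h2 : x.1 ∈ LieIdeal.killingCompl F Q ⊤ := by
    rw [LieIdeal.mem_killingCompl]
    intro y _
    have hy : y ∈ I ⊔ LieIdeal.killingCompl F Q I := by rw [hc.sup_eq_top]; trivial
    obtain ⟨a, ha, b, hb, rfl⟩ := (LieSubmodule.mem_sup _ _ _).1 hy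
    have h3 := h1 ⟨a, ha⟩
    rw [LieIdeal.mem_killingCompl] at hb
    have h4 := hb x x.2
    rw [LieModule.traceForm_comm] at h4
    simp only at h3
    rw [map_add, LinearMap.add_apply, h3, h4, add_zero]
  rw [IsKilling.killingCompl_top_eq_bot] at h2
  ext; simpa using h2

/-- semisimple Lie algebras are perfect, in usable form -/
lemma perfect_induction {Q : Type*} [LieRing Q] [LieAlgebra F Q]
    [Module.Finite F Q] [HasTrivialRadical F Q] (N : Submodule F Q)
    (h : ∀ x y : Q, ⁅x, y⁆ ∈ N) : N = ⊤ := by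
  let I : LieIdeal F Q := { N with lie_mem := fun {x m} _ => h x m }
  have hc := I.isCompl_killingCompl
  have hI : IsLieAbelian (LieIdeal.killingCompl F Q I) := by
    constructor
    intro x y
    have : (⁅x, y⁆ : LieIdeal.killingCompl F Q I).1 ∈ I ⊓ LieIdeal.killingCompl F Q I :=
      ⟨h _ _, (⁅x, y⁆ : LieIdeal.killingCompl F Q I).2⟩
    rw [hc.inf_eq_bot] at this
    ext; simpa using this
  have h0 : LieIdeal.killingCompl F Q I = ⊥ := IsKilling.ideal_eq_bot_of_isLieAbelian _
  rw [h0] at hc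
  have := hc.sup_eq_top
  rw [sup_bot_eq] at this
  rw [eq_top_iff]
  intro x _
  have hx : x ∈ I := by rw [this]; trivial
  exact hx

end GLevi
namespace GLevi
open LieAlgebra Module LieModule

attribute [local instance] LieRing.ofAssociativeRing

variable {F : Type*} [Field F] [CharZero F]

lemma solvable_of_acts_nilpotent {D M : Type*} [LieRing D] [LieAlgebra F D] [Module.Finite F D]
    [AddCommGroup M] [Module F M] [LieRingModule D M] [LieModule F D M] [Module.Finite F M]
    (hinj : Function.Injective (toEnd F D M)) [LieModule.IsNilpotent D M] : IsSolvable D := by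
  have h := (LieModule.isNilpotent_iff_forall' (R := F) (L := D) (M := M)).1 inferInstance
  have h2 : LieRing.IsNilpotent (toEnd F D M).range := by
    rw [LieAlgebra.isNilpotent_iff_forall (R := F)]
    rintro ⟨_, x, rfl⟩
    exact LieAlgebra.isNilpotent_ad_of_isNilpotent (h x)
  have h3 : Function.Injective (toEnd F D M).rangeRestrict := fun x y hxy =>
    hinj (congrArg Subtype.val hxy)
  have : IsSolvable (toEnd F D M).range := inferInstance
  exact h3.lieAlgebra_isSolvable

lemma ker_traceForm_eq_bot {S M : Type*} [LieRing S] [LieAlgebra F S] [Module.Finite F S]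
    [HasTrivialRadical F S]
    [AddCommGroup M] [Module F M] [LieRingModule S M] [LieModule F S M] [Module.Finite F M]
    (hinj : Function.Injective (toEnd F S M)) : LinearMap.ker (traceForm F S M) = ⊥ := by
  let I : LieIdeal F S := { LinearMap.ker (traceForm F S M) with
    lie_mem := fun {x m} hm => by
      have hm : traceForm F S M m = 0 := hm
      change traceForm F S M ⁅x, m⁆ = 0
      ext z
      rw [traceForm_apply_lie_apply', hm]
      simp }
  have h0 : traceForm F I M = 0 := by
    ext x y
    have hx : traceForm F S M x.1 = 0 := x.2
    exact LinearMap.congr_fun hx y.1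
  have hn := isNilpotent_derivedSeries_of_traceForm_eq_zero h0
  have hD : IsSolvable (derivedSeries F I 1) := by
    refine solvable_of_acts_nilpotent (F := F) (M := M) ?_
    intro x y hxy
    ext
    exact hinj (LinearMap.ext fun m => LinearMap.congr_fun hxy m)
  obtain ⟨k, hk⟩ := IsSolvable.solvable F (derivedSeries F I 1)
  rw [LieIdeal.derivedSeries_eq_bot_iff] at hk
  have hI : IsSolvable I := IsSolvable.mk (R := F) (k := k + 1) (by
    rw [derivedSeries_def, derivedSeriesOfIdeal_add]; exact hk)
  have : I = ⊥ := HasTrivialRadical.eq_bot_of_isSolvable I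
  have h5 : I.toSubmodule = ⊥ := by rw [this]; rfl
  exact h5

lemma casimir_faithful {S M : Type*} [LieRing S] [LieAlgebra F S] [Module.Finite F S]
    [HasTrivialRadical F S]
    [AddCommGroup M] [Module F M] [LieRingModule S M] [LieModule F S M] [Module.Finite F M]
    (hinj : Function.Injective (toEnd F S M)) [Nontrivial S] :
    ∃ C : Module.End F M, (∀ (x : S) m, C ⁅x, m⁆ = ⁅x, C m⁆) ∧
      (∀ m, C m ∈ Submodule.span F {⁅x, n⁆ | (x : S) (n : M)}) ∧ ¬ _root_.IsNilpotent C := by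
  classical
  have hk := ker_traceForm_eq_bot (F := F) hinj
  set T : LinearMap.BilinForm F S := traceForm F S M with hT
  have hsymm : T.IsSymm := ⟨fun x y => by simpa using traceForm_comm F S M x y⟩
  have hnd : T.Nondegenerate := by
    refine (traceForm_isSymm F S M).isRefl.nondegenerate_iff_separatingLeft.mpr ?_
    rw [LinearMap.separatingLeft_iff_ker_eq_bot]; exact hk
  let b := Module.finBasis F S
  let d := T.dualBasis hnd b
  let φ := toEnd F S M
  have hb : ∀ y j, b.repr y j = T (d j) y := by
    intro y j
    conv_rhs => rw [← b.sum_repr y]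
    rw [map_sum, Finset.sum_eq_single j]
    · simp [d, LinearMap.BilinForm.apply_dualBasis_left]
    · intro i _ hij
      simp [d, LinearMap.BilinForm.apply_dualBasis_left, hij]
    · simp
  have hd : ∀ y j, d.repr y j = T y (b j) := fun y j =>
    LinearMap.BilinForm.dualBasis_repr_apply hnd b y j
  refine ⟨∑ i, φ (b i) * φ (d i), ?_, ?_, ?_⟩
  · intro x m
    have e1 : ∀ i, ⁅x, b i⁆ = ∑ j, T (d j) ⁅x, b i⁆ • b j := fun i => by
      conv_lhs => rw [← b.sum_repr ⁅x, b i⁆]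
      simp only [hb]
    have e2 : ∀ i, ⁅x, d i⁆ = - ∑ j, T (d i) ⁅x, b j⁆ • d j := fun i => by
      conv_lhs => rw [← d.sum_repr ⁅x, d i⁆]
      simp only [hd]
      rw [← Finset.sum_neg_distrib]
      refine Finset.sum_congr rfl fun j _ => ?_
      rw [hT, traceForm_apply_lie_apply', neg_smul]
    have e3 : ∑ i, ⁅⁅x, b i⁆, ⁅d i, m⁆⁆ + ∑ i, ⁅b i, ⁅⁅x, d i⁆, m⁆⁆ = 0 := by
      have s1 : ∀ i, ⁅⁅x, b i⁆, ⁅d i, m⁆⁆ = ∑ j, T (d j) ⁅x, b i⁆ • ⁅b j, ⁅d i, m⁆⁆ := fun i => by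
        conv_lhs => rw [e1 i]
        rw [sum_lie]
        simp only [smul_lie]
      have s2 : ∀ i, ⁅b i, ⁅⁅x, d i⁆, m⁆⁆ = - ∑ j, T (d i) ⁅x, b j⁆ • ⁅b i, ⁅d j, m⁆⁆ := fun i => by
        conv_lhs => rw [e2 i]
        rw [neg_lie, lie_neg, sum_lie, lie_sum]
        simp only [smul_lie, lie_smul]
      simp only [s1, s2]
      rw [Finset.sum_neg_distrib, Finset.sum_comm, add_neg_cancel]
    simp only [LinearMap.sum_apply, Module.End.mul_apply, φ, toEnd_apply_apply]
    rw [lie_sum]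
    have e4 : ∀ i, ⁅x, ⁅b i, ⁅d i, m⁆⁆⁆ = ⁅⁅x, b i⁆, ⁅d i, m⁆⁆ + ⁅b i, ⁅⁅x, d i⁆, m⁆⁆
        + ⁅b i, ⁅d i, ⁅x, m⁆⁆⁆ := fun i => by
      rw [leibniz_lie x (b i), leibniz_lie x (d i), lie_add, add_assoc]
    simp only [e4, Finset.sum_add_distrib]
    rw [e3, zero_add]
  · intro m
    rw [LinearMap.sum_apply]
    exact Submodule.sum_mem _ fun i _ => Submodule.subset_span ⟨b i, ⁅d i, m⁆, rfl⟩
  · intro hnil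
    have h0 := (LinearMap.isNilpotent_trace_of_isNilpotent hnil).eq_zero
    rw [map_sum] at h0
    have : ∀ i, LinearMap.trace F M (φ (b i) * φ (d i)) = 1 := fun i => by
      have := LinearMap.BilinForm.apply_dualBasis_right hnd hsymm b i i
      simp only [if_true] at this
      rw [← this]; rfl
    simp [this] at h0
    exact (Module.finrank_pos (R := F) (M := S)).ne' h0
end GLevi
namespace GLevi
open LieAlgebra Module LieModule

section
attribute [local instance] LieRing.ofAssociativeRing

variable {F : Type*} [Field F] [CharZero F]

lemma exists_lift {E Q S : Type*} [LieRing E] [LieAlgebra F E] [LieRing Q] [LieAlgebra F Q]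
    [LieRing S] [LieAlgebra F S] (p : E →ₗ⁅F⁆ Q) (hp : Function.Surjective p) (φ : E →ₗ⁅F⁆ S)
    (h : ∀ x, p x = 0 → φ x = 0) : ∃ ψ : Q →ₗ⁅F⁆ S, ∀ x, ψ (p x) = φ x := by
  obtain ⟨g, hg⟩ := hp.hasRightInverse
  have key : ∀ x y, p x = p y → φ x = φ y := fun x y hxy => by
    rw [← sub_eq_zero, ← map_sub]
    exact h _ (by rw [map_sub, hxy, sub_self])
  refine ⟨{ toFun := fun q => φ (g q), map_add' := ?_, map_smul' := ?_, map_lie' := ?_ }, ?_⟩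
  · intro x y
    rw [← map_add]; exact key _ _ (by rw [map_add, hg, hg, hg])
  · intro t x
    rw [RingHom.id_apply, ← map_smul]; exact key _ _ (by rw [map_smul, hg, hg])
  · intro x y
    rw [← LieHom.map_lie]; exact key _ _ (by rw [LieHom.map_lie, hg, hg, hg])
  · intro x
    exact key _ _ (hg _)

lemma casimir {E Q M : Type*} [LieRing E] [LieAlgebra F E] [LieRing Q] [LieAlgebra F Q]
    [Module.Finite F Q] [HasTrivialRadical F Q] (p : E →ₗ⁅F⁆ Q) (hp : Function.Surjective p)
    [AddCommGroup M] [Module F M] [LieRingModule E M] [LieModule F E M] [Module.Finite F M]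
    (hM : ∀ x, p x = 0 → ∀ m : M, ⁅x, m⁆ = 0) (hnt : ∃ (x : E) (m : M), ⁅x, m⁆ ≠ 0) :
    ∃ C : Module.End F M, (∀ (x : E) m, C ⁅x, m⁆ = ⁅x, C m⁆) ∧
      (∀ m, C m ∈ Submodule.span F {⁅x, n⁆ | (x : E) (n : M)}) ∧ ¬ _root_.IsNilpotent C := by
  let S := (toEnd F E M).range
  obtain ⟨ψ, hψ⟩ := exists_lift p hp (toEnd F E M).rangeRestrict (fun x hx => by
    ext m; exact hM x hx m)
  have hψs : Function.Surjective ψ := by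
    rintro ⟨_, x, rfl⟩
    exact ⟨p x, hψ x⟩
  have : HasTrivialRadical F S := hasTrivialRadical_of_surjective ψ hψs
  have : Nontrivial S := by
    obtain ⟨x, m, hxm⟩ := hnt
    refine ⟨⟨(toEnd F E M).rangeRestrict x, 0, fun h => hxm ?_⟩⟩
    have := congrArg Subtype.val h
    exact LinearMap.congr_fun this m
  obtain ⟨C, h1, h2, h3⟩ := casimir_faithful (F := F) (S := S) (M := M) (by
    intro x y hxy
    ext m; exact LinearMap.congr_fun hxy m)
  refine ⟨C, fun x m => h1 ((toEnd F E M).rangeRestrict x) m, fun m => ?_, h3⟩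
  refine Submodule.span_mono ?_ (h2 m)
  rintro _ ⟨⟨_, x, rfl⟩, n, rfl⟩
  exact ⟨x, n, rfl⟩

/-- For a semisimple action, a module is the sum of its invariants and its derived part. -/
lemma weyl {E Q : Type*} [LieRing E] [LieAlgebra F E] [LieRing Q] [LieAlgebra F Q]
    [Module.Finite F Q] [HasTrivialRadical F Q] (p : E →ₗ⁅F⁆ Q) (hp : Function.Surjective p) :
    ∀ (n : ℕ) (M : Type*) [AddCommGroup M] [Module F M] [LieRingModule E M] [LieModule F E M]
    [Module.Finite F M], finrank F M = n →
    (∀ x, p x = 0 → ∀ m : M, ⁅x, m⁆ = 0) →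
    ∀ m : M, ∃ m' : M, (∀ x : E, ⁅x, m'⁆ = 0) ∧
      m - m' ∈ Submodule.span F {⁅x, n⁆ | (x : E) (n : M)} := by
  intro n
  induction n using Nat.strong_induction_on with
  | _ n ih =>
  intro M _ _ _ _ _ hn hM m
  by_cases hnt : ∃ (x : E) (m : M), ⁅x, m⁆ ≠ 0
  swap
  · push Not at hnt
    exact ⟨m, fun x => hnt x m, by simp⟩
  obtain ⟨C, h1, h2, h3⟩ := casimir p hp hM hnt
  obtain ⟨k, hk⟩ := Filter.eventually_atTop.mp C.eventually_isCompl_ker_pow_range_pow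
  have hc := hk (k + 1) (by omega)
  have hcomm : ∀ (j : ℕ) (x : E) m, (C ^ j) ⁅x, m⁆ = ⁅x, (C ^ j) m⁆ := by
    intro j
    induction j with
    | zero => intro x m; rfl
    | succ j ihj => intro x m; rw [pow_succ, Module.End.mul_apply, Module.End.mul_apply, h1, ihj]
  let N : LieSubmodule F E M := { LinearMap.ker (C ^ (k + 1)) with
    lie_mem := fun {x m} hm => by
      have hm : (C ^ (k + 1)) m = 0 := hm
      change (C ^ (k + 1)) ⁅x, m⁆ = 0
      rw [hcomm, hm, lie_zero] }
  have hN : N.toSubmodule = LinearMap.ker (C ^ (k + 1)) := rfl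
  have hlt : finrank F N < n := by
    rw [← hn]
    apply Submodule.finrank_lt (s := N.toSubmodule)
    intro htop
    apply h3
    refine ⟨k + 1, ?_⟩
    rw [hN, LinearMap.ker_eq_top] at htop
    exact htop
  have hm : m ∈ LinearMap.ker (C ^ (k + 1)) ⊔ LinearMap.range (C ^ (k + 1)) := by
    rw [hc.sup_eq_top]; trivial
  obtain ⟨a, ha, _, ⟨b, rfl⟩, rfl⟩ := Submodule.mem_sup.1 hm
  obtain ⟨a', ha1, ha2⟩ := ih _ hlt N rfl (fun x hx y => by
    ext; exact hM x hx y.1) ⟨a, ha⟩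
  refine ⟨a', fun x => congrArg Subtype.val (ha1 x), ?_⟩
  have e : a + (C ^ (k + 1)) b - a'.1 = (a - a'.1) + C ((C ^ k) b) := by
    rw [pow_succ', Module.End.mul_apply]; abel
  rw [e]
  refine Submodule.add_mem _ ?_ (h2 _)
  have := Submodule.mem_map_of_mem (f := N.toSubmodule.subtype) ha2
  rw [Submodule.map_span] at this
  refine Submodule.span_mono ?_ this
  rintro _ ⟨_, ⟨x, y, rfl⟩, rfl⟩
  exact ⟨x, y.1, rfl⟩

end
end GLevi
namespace GLevi
open LieAlgebra Module LieModule

section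

variable {F : Type*} [Field F] [CharZero F]

lemma weyl_rel {E Q W : Type*} [LieRing E] [LieAlgebra F E] [LieRing Q] [LieAlgebra F Q]
    [Module.Finite F Q] [HasTrivialRadical F Q] (p : E →ₗ⁅F⁆ Q) (hp : Function.Surjective p)
    [AddCommGroup W] [Module F W] [LieRingModule E W] [LieModule F E W] [Module.Finite F W]
    (N A : LieSubmodule F E W) (hNA : ∀ x, p x = 0 → ∀ m ∈ N, ⁅x, m⁆ ∈ A) (m : W) (hm : m ∈ N) :
    ∃ m' ∈ N, (∀ x : E, ⁅x, m'⁆ ∈ A) ∧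
      ∃ a ∈ A, m - m' - a ∈ Submodule.span F {w : W | ∃ x : E, ∃ n ∈ N, ⁅x, n⁆ = w} := by
  let π := LieSubmodule.Quotient.mk' A
  have hπ : ∀ w, π w = 0 ↔ w ∈ A := fun w => LieSubmodule.Quotient.mk_eq_zero'
  let M := N.map π
  obtain ⟨⟨m', hm'⟩, h1, h2⟩ := weyl p hp (finrank F M) M rfl (by
    rintro x hx ⟨_, n, hn, rfl⟩
    ext
    change ⁅x, π n⁆ = 0
    rw [← LieModuleHom.map_lie, hπ]
    exact hNA x hx n hn) ⟨π m, ⟨m, hm, rfl⟩⟩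
  obtain ⟨n, hn, rfl⟩ := hm'
  refine ⟨n, hn, fun x => ?_, ?_⟩
  · rw [← hπ, LieModuleHom.map_lie]
    exact congrArg Subtype.val (h1 x)
  · have h3 := Submodule.mem_map_of_mem (f := M.toSubmodule.subtype) h2
    have h4 : π (m - n) ∈ Submodule.map (π : W →ₗ[F] W ⧸ A)
        (Submodule.span F {w : W | ∃ x : E, ∃ n ∈ N, ⁅x, n⁆ = w}) := by
      rw [map_sub]
      rw [Submodule.map_span] at h3 ⊢
      refine Submodule.span_mono ?_ h3
      rintro _ ⟨_, ⟨x, ⟨_, k, hk, rfl⟩, rfl⟩, rfl⟩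
      exact ⟨⁅x, k⁆, ⟨x, k, hk, rfl⟩, LieModuleHom.map_lie π x k⟩
    obtain ⟨w, hw, hw2⟩ := h4
    have hw2 : π w = π (m - n) := hw2
    refine ⟨m - n - w, ?_, by simpa using hw⟩
    rw [← hπ, map_sub, hw2, sub_self]

/-- `ad V` as a submodule. -/
def adKer {E Q : Type*} [LieRing E] [LieAlgebra F E] [LieRing Q] [LieAlgebra F Q]
    (p : E →ₗ⁅F⁆ Q) : LieSubmodule F E (E →ₗ[F] E) where
  carrier := {h | ∃ v, p v = 0 ∧ ∀ y, h y = ⁅v, y⁆}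
  zero_mem' := ⟨0, by simp, by simp⟩
  add_mem' := by
    rintro a b ⟨v, hv, hv'⟩ ⟨w, hw, hw'⟩
    exact ⟨v + w, by simp [hv, hw], by simp [hv', hw']⟩
  smul_mem' := by
    rintro c a ⟨v, hv, hv'⟩
    exact ⟨c • v, by simp [hv], by simp [hv']⟩
  lie_mem := by
    rintro x a ⟨v, hv, hv'⟩
    refine ⟨⁅x, v⁆, by simp [hv], fun y => ?_⟩
    rw [LieHom.lie_apply, hv', hv', leibniz_lie]; abel

/-- Maps into the kernel that are scalar on the kernel. -/
def scalKer {E Q : Type*} [LieRing E] [LieAlgebra F E] [LieRing Q] [LieAlgebra F Q]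
    (p : E →ₗ⁅F⁆ Q) : LieSubmodule F E (E →ₗ[F] E) where
  carrier := {h | (∀ y, p (h y) = 0) ∧ ∃ c : F, ∀ v, p v = 0 → h v = c • v}
  zero_mem' := ⟨by simp, 0, by simp⟩
  add_mem' := by
    rintro a b ⟨ha, c, hc⟩ ⟨hb, d, hd⟩
    exact ⟨by simp [ha, hb], c + d, fun v hv => by simp [hc v hv, hd v hv, add_smul]⟩
  smul_mem' := by
    rintro t a ⟨ha, c, hc⟩
    exact ⟨by simp [ha], t * c, fun v hv => by simp [hc v hv, mul_smul]⟩
  lie_mem := by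
    rintro x a ⟨ha, c, hc⟩
    refine ⟨fun y => by simp [LieHom.lie_apply, ha], 0, fun v hv => ?_⟩
    rw [LieHom.lie_apply, hc v hv, hc _ (by simp [hv])]; simp

lemma stepA {E Q : Type*} [LieRing E] [LieAlgebra F E] [LieRing Q] [LieAlgebra F Q]
    [Module.Finite F Q] [Module.Finite F E] [HasTrivialRadical F Q] (p : E →ₗ⁅F⁆ Q)
    (hp : Function.Surjective p)
    (hV : ∀ v w, p v = 0 → p w = 0 → ⁅v, w⁆ = 0) :
    ∃ f : E →ₗ[F] E, (∀ y, p (f y) = 0) ∧ (∀ v, p v = 0 → f v = v) ∧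
      ∀ x : E, ∃ v : E, p v = 0 ∧ ∀ y, ⁅x, f y⁆ - f ⁅x, y⁆ = ⁅v, y⁆ := by
  obtain ⟨f₀, hf₀⟩ := Submodule.exists_isCompl (LinearMap.ker (p : E →ₗ[F] Q))
  let V := LinearMap.ker (p : E →ₗ[F] Q)
  let f₁ : E →ₗ[F] E := V.subtype ∘ₗ Submodule.projectionOnto V f₀ hf₀
  have h1 : ∀ y, p (f₁ y) = 0 := fun y => (Submodule.projectionOnto V f₀ hf₀ y).2
  have h2 : ∀ v, p v = 0 → f₁ v = v := fun v hv => by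
    have := Submodule.projectionOnto_apply_left hf₀ ⟨v, hv⟩
    exact congrArg Subtype.val this
  obtain ⟨f, ⟨hf, c, hc⟩, hfA, a, ⟨v, hv, hav⟩, hs⟩ := weyl_rel p hp (scalKer p) (adKer p) (by
    rintro x hx m ⟨hm, c, hc⟩
    refine ⟨-c • x, by simp [hx], fun y => ?_⟩
    rw [LieHom.lie_apply, hV _ _ hx (hm y), hc _ (by simp [hx])]
    simp) f₁ ⟨h1, 1, by simpa using h2⟩
  refine ⟨f, hf, fun w hw => ?_, fun x => ?_⟩
  · have h3 : ∀ g ∈ Submodule.span F {w : E →ₗ[F] E | ∃ x : E, ∃ n ∈ scalKer p, ⁅x, n⁆ = w},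
        g w = 0 := by
      intro g hg
      induction hg using Submodule.span_induction with
      | mem g hg =>
        obtain ⟨x, n, ⟨hn, c, hc⟩, rfl⟩ := hg
        rw [LieHom.lie_apply, hc _ hw, hc _ (by simp [hw])]; simp
      | zero => rfl
      | add a b _ _ ha hb => simp [ha, hb]
      | smul t a _ ha => simp [ha]
    have h4 := h3 _ hs
    rw [LinearMap.sub_apply, LinearMap.sub_apply, hav, hV _ _ hv hw, sub_zero, sub_eq_zero,
      h2 w hw] at h4
    exact h4.symm
  · obtain ⟨v, hv, hv'⟩ := hfA x
    exact ⟨v, hv, fun y => by rw [← hv', LieHom.lie_apply]⟩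

lemma stepB {E Q G : Type*} [LieRing E] [LieAlgebra F E] [LieRing Q] [LieAlgebra F Q]
    [LieRing G] [LieAlgebra F G]
    [Module.Finite F Q] [Module.Finite F E] [Module.Finite F G] [HasTrivialRadical F Q]
    [HasTrivialRadical F G] (p : E →ₗ⁅F⁆ Q)
    (hp : Function.Surjective p) (j : G →ₗ⁅F⁆ E)
    (hV : ∀ v w, p v = 0 → p w = 0 → ⁅v, w⁆ = 0) :
    ∃ f : E →ₗ[F] E, (∀ y, p (f y) = 0) ∧ (∀ v, p v = 0 → f v = v) ∧
      (∀ x : E, ∃ v : E, p v = 0 ∧ ∀ y, ⁅x, f y⁆ - f ⁅x, y⁆ = ⁅v, y⁆) ∧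
      ∀ g y, ⁅j g, f y⁆ - f ⁅j g, y⁆ = 0 := by
  obtain ⟨f, h1, h2, h3⟩ := stepA p hp hV
  have hG : HasTrivialRadical F j.range :=
    hasTrivialRadical_of_surjective j.rangeRestrict j.surjective_rangeRestrict
  let N : LieSubmodule F j.range (E →ₗ[F] E) :=
  { carrier := {h | ∃ (c : F) (v : E), p v = 0 ∧ ∀ y, h y = c • f y + ⁅v, y⁆}
    zero_mem' := ⟨0, 0, by simp, by simp⟩
    add_mem' := by
      rintro a b ⟨c, v, hv, hv'⟩ ⟨d, w, hw, hw'⟩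
      exact ⟨c + d, v + w, by simp [hv, hw], fun y => by
        simp only [LinearMap.add_apply, hv', hw', add_smul, add_lie]; abel⟩
    smul_mem' := by
      rintro t a ⟨c, v, hv, hv'⟩
      exact ⟨t * c, t • v, by simp [hv], fun y => by simp [hv', mul_smul]⟩
    lie_mem := by
      rintro x a ⟨c, v, hv, hv'⟩
      obtain ⟨w, hw, hw'⟩ := h3 x
      refine ⟨0, c • w + ⁅(x : E), v⁆, by simp [hw, hv], fun y => ?_⟩
      rw [LieHom.lie_apply, LieSubalgebra.coe_bracket_of_module,
        LieSubalgebra.coe_bracket_of_module, hv', hv', add_lie, smul_lie, ← hw', lie_add,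
        leibniz_lie (x : E) v y, lie_smul, smul_sub]
      simp only [zero_smul]; abel }
  have hN : ∀ n ∈ N, (∀ y, p (n y) = 0) ∧ ∃ c : F, ∀ w, p w = 0 → n w = c • w := by
    rintro n ⟨c, v, hv, hv'⟩
    exact ⟨fun y => by simp [hv', h1, hv], c, fun w hw => by
      rw [hv', hV _ _ hv hw, h2 w hw, add_zero]⟩
  obtain ⟨f', hf', hfA, a, ha, hs⟩ := weyl_rel (LieHom.id : j.range →ₗ⁅F⁆ j.range)
    Function.surjective_id N ⊥ (by
      rintro x hx m -
      have hx : x = 0 := hx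
      simp [hx]) f ⟨1, 0, by simp, by simp⟩
  refine ⟨f', (hN f' hf').1, fun w hw => ?_, fun x => ?_, fun g y => ?_⟩
  · have h3 : ∀ g ∈ Submodule.span F {w : E →ₗ[F] E | ∃ x : j.range, ∃ n ∈ N, ⁅x, n⁆ = w},
        g w = 0 := by
      intro g hg
      induction hg using Submodule.span_induction with
      | mem g hg =>
        obtain ⟨x, n, hn, rfl⟩ := hg
        obtain ⟨-, c, hc⟩ := hN n hn
        rw [LieHom.lie_apply, LieSubalgebra.coe_bracket_of_module,
          LieSubalgebra.coe_bracket_of_module, hc _ hw, hc _ (by simp [hw])]; simp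
      | zero => rfl
      | add a b _ _ ha hb => simp [ha, hb]
      | smul t a _ ha => simp [ha]
    have h4 := h3 _ hs
    rw [(LieSubmodule.mem_bot a).1 ha, sub_zero, LinearMap.sub_apply, sub_eq_zero,
      h2 w hw] at h4
    exact h4.symm
  · obtain ⟨c, v, hv, hv'⟩ := hf'
    obtain ⟨w, hw, hw'⟩ := h3 x
    refine ⟨c • w + ⁅x, v⁆, by simp [hw, hv], fun y => ?_⟩
    rw [hv', hv', add_lie, smul_lie, ← hw', lie_add,
        leibniz_lie x v y, lie_smul, smul_sub]
    abel
  · have := (LieSubmodule.mem_bot _).1 (hfA ⟨j g, ⟨g, rfl⟩⟩)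
    have := LinearMap.congr_fun this y
    exact this

lemma stepC {E Q G : Type*} [LieRing E] [LieAlgebra F E] [LieRing Q] [LieAlgebra F Q]
    [LieRing G] [LieAlgebra F G]
    [Module.Finite F Q] [Module.Finite F E] [Module.Finite F G] [HasTrivialRadical F Q]
    [HasTrivialRadical F G] (p : E →ₗ⁅F⁆ Q)
    (hp : Function.Surjective p) (j : G →ₗ⁅F⁆ E)
    (hV : ∀ v w, p v = 0 → p w = 0 → ⁅v, w⁆ = 0) :
    ∃ s : Q →ₗ⁅F⁆ E, (∀ q, p (s q) = q) ∧ ∀ g, s (p (j g)) = j g := by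
  obtain ⟨f, h1, h2, h3, h4⟩ := stepB p hp j hV
  let B : LieSubalgebra F E :=
  { carrier := {x | ∀ y, ⁅x, f y⁆ = f ⁅x, y⁆}
    zero_mem' := by simp
    add_mem' := by
      intro a b ha hb y
      rw [add_lie, add_lie, map_add, ha, hb]
    smul_mem' := by
      intro c a ha y
      rw [smul_lie, smul_lie, map_smul, ha]
    lie_mem' := by
      intro a b ha hb y
      rw [lie_lie, lie_lie, hb, ha, ha, hb, map_sub] }
  let pB : B →ₗ⁅F⁆ Q := p.comp B.incl
  have hpB' : ∀ b : B, pB b = p b := fun _ => rfl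
  have hpB : Function.Surjective pB := by
    intro q
    obtain ⟨x, rfl⟩ := hp q
    obtain ⟨v, hv, hv'⟩ := h3 x
    refine ⟨⟨x + v, fun y => ?_⟩, by rw [hpB']; simp [hv]⟩
    have e1 : ⁅v, f y⁆ = 0 := hV _ _ hv (h1 y)
    have e2 : f ⁅v, y⁆ = ⁅v, y⁆ := h2 _ (by simp [hv])
    rw [add_lie, add_lie, map_add, e1, e2, ← hv']; abel
  have hz : ∀ z : B, pB z = 0 → ∀ b : B, ⁅z, b⁆ = 0 := by
    intro z hz b
    have e1 : ⁅(z : E), f b⁆ = 0 := hV _ _ hz (h1 b)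
    have e2 : f ⁅(z : E), (b : E)⁆ = ⁅(z : E), (b : E)⁆ := h2 _ (by
      rw [LieHom.map_lie, ← hpB', hz, zero_lie])
    have e3 := z.2 b
    rw [e1, e2] at e3
    ext; exact e3.symm
  obtain ⟨k, k1, k2, k3⟩ := stepA pB hpB (fun v w hv _ => hz v hv w)
  have k4 : ∀ x y : B, k ⁅x, y⁆ = 0 := by
    intro x y
    obtain ⟨v, hv, hv'⟩ := k3 x
    have := hv' y
    rw [hz v hv, ← lie_skew, hz _ (k1 y), neg_zero, zero_sub, neg_eq_zero] at this
    exact this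
  -- the section, as a linear map
  have k5 : ∀ b, k (b - k b) = 0 := fun b => by rw [map_sub, k2 _ (k1 b), sub_self]
  have kz : ∀ b, pB b = 0 → k b = 0 → b = 0 := fun b hb hb' => by rw [← k2 b hb, hb']
  have hex : ∀ q, ∃ b : B, pB b = q ∧ k b = 0 := fun q => by
    obtain ⟨b, rfl⟩ := hpB q
    exact ⟨b - k b, by rw [map_sub, k1, sub_zero], k5 b⟩
  choose s hs1 hs2 using hex
  have huniq : ∀ a b : B, pB a = pB b → k a = 0 → k b = 0 → a = b := fun a b h ha hb => by
    rw [← sub_eq_zero]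
    exact kz _ (by rw [map_sub, h, sub_self]) (by rw [map_sub, ha, hb, sub_self])
  let S : Q →ₗ⁅F⁆ B :=
  { toFun := s
    map_add' := fun x y => huniq _ _ (by simp [hs1]) (hs2 _) (by simp [hs2])
    map_smul' := fun c y => huniq _ _ (by simp [hs1]) (hs2 _) (by simp [hs2])
    map_lie' := fun {x y} => huniq _ _ (by simp [hs1]) (hs2 _) (by simp [k4]) }
  refine ⟨B.incl.comp S, fun q => hs1 q, fun g => ?_⟩
  let jB : G →ₗ⁅F⁆ B :=
  { toFun := fun g => ⟨j g, fun y => sub_eq_zero.1 (h4 g y)⟩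
    map_add' := fun x y => by ext; simp
    map_smul' := fun c y => by ext; simp
    map_lie' := fun {x y} => by ext; simp }
  have hk : LinearMap.ker (k ∘ₗ (jB : G →ₗ[F] B)) = ⊤ := perfect_induction _ (fun x y => by
    change k (jB ⁅x, y⁆) = 0
    rw [LieHom.map_lie, k4])
  have hkg : k (jB g) = 0 := by
    have : g ∈ LinearMap.ker (k ∘ₗ (jB : G →ₗ[F] B)) := by rw [hk]; trivial
    exact this
  have : s (p (j g)) = jB g := huniq _ _ (hs1 _) (hs2 _) hkg
  exact congrArg Subtype.val this

end
end GLevi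
namespace GLevi
open LieAlgebra Module LieModule

section

variable {F : Type*} [Field F] [CharZero F]

/-- The quotient map as a Lie homomorphism. -/
def quotHom {E : Type*} [LieRing E] [LieAlgebra F E] (V : LieIdeal F E) : E →ₗ⁅F⁆ E ⧸ V :=
  { (LieSubmodule.Quotient.mk' V : E →ₗ[F] E ⧸ V) with map_lie' := rfl }

lemma quotHom_eq_zero {E : Type*} [LieRing E] [LieAlgebra F E] (V : LieIdeal F E) (x : E) :
    quotHom V x = 0 ↔ x ∈ V := LieSubmodule.Quotient.mk_eq_zero'

lemma quotHom_surjective {E : Type*} [LieRing E] [LieAlgebra F E] (V : LieIdeal F E) :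
    Function.Surjective (quotHom V) := LieSubmodule.Quotient.surjective_mk' V

lemma derived_lt {E : Type*} [LieRing E] [LieAlgebra F E] (R : LieIdeal F E) [IsSolvable R]
    (h : ⁅R, R⁆ = R) : R = ⊥ := by
  obtain ⟨k, hk⟩ := IsSolvable.solvable F R
  rw [LieIdeal.derivedSeries_eq_bot_iff] at hk
  rw [← hk]
  clear hk
  induction k with
  | zero => rfl
  | succ k ih => rw [derivedSeriesOfIdeal_succ, ← ih, h]

lemma section_solvable {Q G : Type*} [LieRing Q] [LieAlgebra F Q]
    [LieRing G] [LieAlgebra F G]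
    [Module.Finite F Q] [Module.Finite F G] [HasTrivialRadical F Q]
    [HasTrivialRadical F G] : ∀ (n : ℕ) (E : Type*) [LieRing E] [LieAlgebra F E]
    [Module.Finite F E] (p : E →ₗ⁅F⁆ Q) [IsSolvable p.ker],
    Function.Surjective p → ∀ (j : G →ₗ⁅F⁆ E), finrank F p.ker = n →
    ∃ s : Q →ₗ⁅F⁆ E, (∀ q, p (s q) = q) ∧ ∀ g, s (p (j g)) = j g := by
  intro n
  induction n using Nat.strong_induction_on with
  | _ n ih =>
  intro E _ _ _ p _ hp j hn
  let V : LieIdeal F E := ⁅p.ker, p.ker⁆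
  have hVle : V ≤ p.ker := LieSubmodule.lie_le_left _ _
  have hbr : ∀ v w, p v = 0 → p w = 0 → ⁅v, w⁆ ∈ V := fun v w hv hw =>
    LieSubmodule.lie_mem_lie (LieHom.mem_ker.2 hv) (LieHom.mem_ker.2 hw)
  by_cases hV : V = p.ker
  · have h0 := derived_lt p.ker hV
    refine stepC p hp j (fun v w hv hw => ?_)
    have : ⁅v, w⁆ ∈ V := hbr v w hv hw
    rw [hV, h0] at this
    simpa using this
  have hlt : finrank F V < n := by
    rw [← hn]
    refine Submodule.finrank_lt_finrank_of_lt (s := V.toSubmodule) (t := p.ker.toSubmodule) ?_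
    exact lt_of_le_of_ne hVle (fun h => hV (LieSubmodule.toSubmodule_injective h))
  let mk := quotHom V
  obtain ⟨pb, hpb⟩ := exists_lift mk (quotHom_surjective V) p (fun x hx =>
    LieHom.mem_ker.1 (hVle ((quotHom_eq_zero V x).1 hx)))
  obtain ⟨s, hs1, hs2⟩ := stepC pb (fun q => by
    obtain ⟨x, rfl⟩ := hp q
    exact ⟨mk x, hpb x⟩) (mk.comp j) (fun v w hv hw => by
    obtain ⟨v, rfl⟩ := quotHom_surjective V v
    obtain ⟨w, rfl⟩ := quotHom_surjective V w
    rw [hpb] at hv hw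
    rw [← LieHom.map_lie, quotHom_eq_zero]
    exact hbr v w hv hw)
  let E1 : LieSubalgebra F E :=
  { carrier := {x | mk x = s (p x)}
    zero_mem' := by simp
    add_mem' := by
      intro a b ha hb
      have ha : mk a = s (p a) := ha
      have hb : mk b = s (p b) := hb
      change mk (a + b) = s (p (a + b))
      simp only [map_add, ha, hb]
    smul_mem' := by
      intro c a ha
      have ha : mk a = s (p a) := ha
      change mk (c • a) = s (p (c • a))
      simp only [map_smul, ha]
    lie_mem' := by
      intro a b ha hb
      have ha : mk a = s (p a) := ha
      have hb : mk b = s (p b) := hb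
      change mk ⁅a, b⁆ = s (p ⁅a, b⁆)
      simp only [LieHom.map_lie, ha, hb] }
  have hE1 : ∀ x, x ∈ E1 ↔ mk x = s (p x) := fun _ => Iff.rfl
  let p1 : E1 →ₗ⁅F⁆ Q := p.comp E1.incl
  have hp1 : Function.Surjective p1 := by
    intro q
    obtain ⟨y, hy⟩ := quotHom_surjective V (s q)
    have hy' : p y = q := by rw [← hpb, hy, hs1]
    exact ⟨⟨y, by rw [hE1, hy']; exact hy⟩, hy'⟩
  have hkV : ∀ x : p1.ker, (x : E1).1 ∈ V := by
    rintro ⟨⟨x, hx⟩, hx'⟩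
    have hx' : p x = 0 := hx'
    rw [hE1, hx', map_zero] at hx
    exact (quotHom_eq_zero V x).1 hx
  let ι : p1.ker →ₗ⁅F⁆ p.ker :=
  { toFun := fun x => ⟨x.1.1, hVle (hkV x)⟩
    map_add' := fun _ _ => rfl
    map_smul' := fun _ _ => rfl
    map_lie' := rfl }
  have hι : Function.Injective ι := fun x y hxy => by
    have : x.1.1 = y.1.1 := congrArg (fun z : p.ker => (z : E)) hxy
    exact Subtype.ext (Subtype.ext this)
  have : IsSolvable p1.ker := hι.lieAlgebra_isSolvable
  have hfr : finrank F p1.ker ≤ finrank F V := by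
    let ι' : p1.ker →ₗ[F] V :=
    { toFun := fun x => ⟨x.1.1, hkV x⟩
      map_add' := fun _ _ => rfl
      map_smul' := fun _ _ => rfl }
    refine LinearMap.finrank_le_finrank_of_injective (f := ι') (fun x y hxy => ?_)
    have : x.1.1 = y.1.1 := congrArg (fun z : V => (z : E)) hxy
    exact Subtype.ext (Subtype.ext this)
  let j1 : G →ₗ⁅F⁆ E1 :=
  { toFun := fun g => ⟨j g, by rw [hE1, ← hpb]; exact (hs2 g).symm⟩
    map_add' := fun x y => by ext; simp
    map_smul' := fun c y => by ext; simp
    map_lie' := fun {x y} => by ext; simp }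
  obtain ⟨t, ht1, ht2⟩ := ih _ (lt_of_le_of_lt hfr hlt) E1 p1 hp1 j1 rfl
  exact ⟨E1.incl.comp t, ht1, fun g => congrArg Subtype.val (ht2 g)⟩

end
end GLevi
namespace GLevi
open LieAlgebra Module LieModule

section

variable {F : Type*} [Field F] [CharZero F]

lemma map_solvable_zero {L S : Type*} [LieRing L] [LieAlgebra F L] [LieRing S] [LieAlgebra F S]
    [HasTrivialRadical F S] (f : L →ₗ⁅F⁆ S) (hf : Function.Surjective f) (I : LieIdeal F L)
    (hI : IsSolvable I) (x : L) (hx : x ∈ I) : f x = 0 := by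
  let J : LieIdeal F S :=
  { I.toSubmodule.map (f : L →ₗ[F] S) with
    lie_mem := by
      rintro y _ ⟨x, hx, rfl⟩
      obtain ⟨z, rfl⟩ := hf y
      exact ⟨⁅z, x⁆, lie_mem_right F L I z x hx, LieHom.map_lie f z x⟩ }
  have hI' : IsSolvable I.toLieSubalgebra := hI
  have hs : Function.Surjective (comapHom f I.toLieSubalgebra J.toLieSubalgebra
      (fun x hx => ⟨x, hx, rfl⟩)) := by
    rintro ⟨_, x, hx, rfl⟩
    exact ⟨⟨x, hx⟩, rfl⟩
  have hJ : IsSolvable J := hs.lieAlgebra_isSolvable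
  have hJ0 : J = ⊥ := HasTrivialRadical.eq_bot_of_isSolvable J
  have : f x ∈ J := ⟨x, hx, rfl⟩
  rw [hJ0] at this
  simpa using this

lemma solvable_comap_inj {L S : Type*} [LieRing L] [LieAlgebra F L] [LieRing S] [LieAlgebra F S]
    (f : L →ₗ⁅F⁆ S) (hf : Function.Injective f) (I : LieIdeal F S) [hI : IsSolvable I] :
    IsSolvable (LieIdeal.comap f I) := by
  have hI' : IsSolvable I.toLieSubalgebra := hI
  have hs : Function.Injective (comapHom f (LieIdeal.comap f I).toLieSubalgebra I.toLieSubalgebra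
      (fun x hx => by simpa using hx)) := by
    intro x y hxy
    have : f x = f y := congrArg (fun z : I.toLieSubalgebra => (z : S)) hxy
    exact Subtype.ext (hf this)
  exact hs.lieAlgebra_isSolvable

open LieAlgebra.SemiDirectSum

theorem main {L 𝔤 : Type*} [LieRing L] [LieAlgebra F L] [Module.Finite F L]
    [LieRing 𝔤] [LieAlgebra F 𝔤] [Module.Finite F 𝔤] [HasTrivialRadical F 𝔤]
    (ρ : 𝔤 →ₗ⁅F⁆ LieDerivation F L L) :
    ∃ B : LieSubalgebra F L, HasTrivialRadical F B ∧
      (∀ B' : LieSubalgebra F L, B ≤ B' → HasTrivialRadical F B' → B' = B) ∧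
      (∀ x : 𝔤, ∀ b ∈ B, ρ x b ∈ B) ∧
      IsCompl B.toSubmodule (LieAlgebra.radical F L).toSubmodule := by
  let E := L ⋊⁅ρ⁆ 𝔤
  have : Module.Finite F E := Module.Finite.equiv (toProdl ρ).symm
  let K := radical F E
  have : HasTrivialRadical F (E ⧸ K) := hasTrivialRadical_quot
  let π : E →ₗ⁅F⁆ E ⧸ K := quotHom K
  have hπ : ∀ e, π e = 0 ↔ e ∈ K := quotHom_eq_zero K
  have hker : π.ker = K := by ext e; rw [LieHom.mem_ker, hπ]
  have : IsSolvable π.ker := by rw [hker]; infer_instance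
  obtain ⟨s, hs1, hs2⟩ := section_solvable _ E π (quotHom_surjective K) (inr ρ) rfl
  have hK : ∀ e ∈ K, e.right = 0 := fun e he =>
    map_solvable_zero (projr ρ) (projr_surjective ρ) K inferInstance e he
  -- the section applied to the ideal `L`
  have hsr : ∀ e : E, e.right = 0 → (s (π e)).right = 0 := by
    intro e he
    have h1 : s (π e) - e ∈ K := by rw [← hπ, map_sub, hs1, sub_self]
    have h2 := hK _ h1
    have h3 : (s (π e) - e).right = (s (π e)).right - e.right := rfl
    rw [h3, he, sub_zero] at h2
    exact h2
  have hin : ∀ e : E, e.right = 0 → inl ρ e.left = e := by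
    rintro ⟨a, b⟩ h
    have h : b = 0 := h
    rw [h]; rfl
  let B : LieSubalgebra F L :=
  { carrier := {l | s (π (inl ρ l)) = inl ρ l}
    zero_mem' := by
      change s (π (inl ρ 0)) = inl ρ 0
      simp only [map_zero]
    add_mem' := by
      intro a b ha hb
      have ha : s (π (inl ρ a)) = inl ρ a := ha
      have hb : s (π (inl ρ b)) = inl ρ b := hb
      change s (π (inl ρ (a + b))) = inl ρ (a + b)
      simp only [map_add, ha, hb]
    smul_mem' := by
      intro c a ha
      have ha : s (π (inl ρ a)) = inl ρ a := ha
      change s (π (inl ρ (c • a))) = inl ρ (c • a)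
      simp only [map_smul, ha]
    lie_mem' := by
      intro a b ha hb
      have ha : s (π (inl ρ a)) = inl ρ a := ha
      have hb : s (π (inl ρ b)) = inl ρ b := hb
      change s (π (inl ρ ⁅a, b⁆)) = inl ρ ⁅a, b⁆
      simp only [LieHom.map_lie, ha, hb] }
  have hB : ∀ l, l ∈ B ↔ s (π (inl ρ l)) = inl ρ l := fun _ => Iff.rfl
  let I : LieIdeal F (E ⧸ K) :=
  { (projr ρ).ker.toSubmodule.map (π : E →ₗ[F] E ⧸ K) with
    lie_mem := by
      rintro y _ ⟨x, hx, rfl⟩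
      obtain ⟨z, rfl⟩ := quotHom_surjective K y
      exact ⟨⁅z, x⁆, lie_mem_right F E (projr ρ).ker z x hx, LieHom.map_lie π z x⟩ }
  have hI : ∀ q, q ∈ I ↔ ∃ e : E, e.right = 0 ∧ π e = q := fun _ => Iff.rfl
  have hItr : HasTrivialRadical F I := hasTrivialRadical_ideal I
  have hIs : ∀ q ∈ I, (s q).right = 0 := by
    intro q hq
    obtain ⟨e, he, rfl⟩ := (hI q).1 hq
    exact hsr e he
  have hsB : ∀ q ∈ I, (s q).left ∈ B := by
    intro q hq
    rw [hB, hin _ (hIs q hq), hs1]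
  have hBtr : HasTrivialRadical F B := by
    let θ : I →ₗ⁅F⁆ B :=
    { toFun := fun q => ⟨(s q.1).left, hsB q.1 q.2⟩
      map_add' := fun x y => by
        apply Subtype.ext
        change (s (x.1 + y.1)).left = (s x.1).left + (s y.1).left
        rw [map_add]; rfl
      map_smul' := fun c x => by
        apply Subtype.ext
        change (s (c • x.1)).left = c • (s x.1).left
        rw [map_smul]; rfl
      map_lie' := fun {x y} => by
        apply Subtype.ext
        change (s ⁅x.1, y.1⁆).left = ⁅(s x.1).left, (s y.1).left⁆
        rw [LieHom.map_lie, lie_eq_mk, hIs _ x.2, hIs _ y.2]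
        simp }
    refine hasTrivialRadical_of_surjective θ ?_
    rintro ⟨b, hb⟩
    refine ⟨⟨π (inl ρ b), (hI _).2 ⟨inl ρ b, rfl, rfl⟩⟩, ?_⟩
    apply Subtype.ext
    change (s (π (inl ρ b))).left = b
    rw [(hB b).1 hb]; rfl
  have hrad : ∀ l, l ∈ radical F L ↔ π (inl ρ l) = 0 := by
    intro l
    constructor
    · intro hl
      let g : L →ₗ⁅F⁆ I :=
      { toFun := fun l => ⟨π (inl ρ l), (hI _).2 ⟨inl ρ l, rfl, rfl⟩⟩
        map_add' := fun x y => by apply Subtype.ext; simp only [map_add]; rfl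
        map_smul' := fun c x => by apply Subtype.ext; simp only [map_smul]; rfl
        map_lie' := fun {x y} => by apply Subtype.ext; simp only [LieHom.map_lie]; rfl }
      have hg : Function.Surjective g := by
        rintro ⟨q, hq⟩
        obtain ⟨e, he, rfl⟩ := (hI q).1 hq
        exact ⟨e.left, Subtype.ext (congrArg π (hin e he))⟩
      have := map_solvable_zero g hg (radical F L) inferInstance l hl
      exact congrArg (fun z : I => (z : E ⧸ K)) this
    · intro hl
      have h1 : IsSolvable (LieIdeal.comap (inl ρ) K) :=
        solvable_comap_inj (inl ρ) (inl_injective ρ) K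
      rw [LieIdeal.solvable_iff_le_radical] at h1
      apply h1
      rw [LieIdeal.mem_comap, ← hπ]
      exact hl
  have hdec : ∀ l, ∃ b ∈ B, l - b ∈ radical F L := by
    intro l
    have hq : π (inl ρ l) ∈ I := (hI _).2 ⟨inl ρ l, rfl, rfl⟩
    refine ⟨(s (π (inl ρ l))).left, hsB _ hq, ?_⟩
    rw [hrad, map_sub, hin _ (hIs _ hq), map_sub, hs1, sub_self]
  refine ⟨B, hBtr, ?_, ?_, ?_⟩
  · intro B' hBB' hB'
    refine le_antisymm (fun x hx => ?_) hBB'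
    obtain ⟨b, hb, hxb⟩ := hdec x
    have h1 : IsSolvable (LieIdeal.comap B'.incl (radical F L)) :=
      solvable_comap_inj B'.incl Subtype.val_injective _
    have h2 : LieIdeal.comap B'.incl (radical F L) = ⊥ :=
      HasTrivialRadical.eq_bot_of_isSolvable _
    have h3 : (⟨x - b, sub_mem hx (hBB' hb)⟩ : B') ∈ LieIdeal.comap B'.incl (radical F L) := by
      rw [LieIdeal.mem_comap]; exact hxb
    rw [h2, LieSubmodule.mem_bot] at h3
    have h4 : x - b = 0 := congrArg Subtype.val h3
    rw [sub_eq_zero] at h4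
    rw [h4]; exact hb
  · intro x b hb
    have h1 : inl ρ (ρ x b) = ⁅inr ρ x, inl ρ b⁆ := by simp
    rw [hB, h1, LieHom.map_lie, LieHom.map_lie, hs2, (hB b).1 hb]
  · constructor
    · rw [Submodule.disjoint_def]
      intro b hb hb'
      have h1 : s (π (inl ρ b)) = inl ρ b := hb
      have h2 : π (inl ρ b) = 0 := (hrad b).1 hb'
      rw [h2, map_zero] at h1
      exact inl_injective ρ (by rw [← h1, map_zero])
    · rw [codisjoint_iff, eq_top_iff]
      intro l _
      obtain ⟨b, hb, hlb⟩ := hdec l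
      exact Submodule.mem_sup.2 ⟨b, hb, l - b, hlb, by abel⟩

end
end GLevi

/-- Let `L` be a finite dimensional Lie algebra over an algebraically closed
field `F` of characteristic `0` and let `𝔤` be a finite dimensional semisimple Lie algebra
acting on `L` by derivations.  Then there exists a maximal semisimple subalgebra (a Levi
subalgebra) `B ⊆ L` which is a `𝔤`-submodule such that `L = B ⊕ R` where `R` is the
solvable radical of `L` (the `𝔤`-equivariant Levi decomposition). -/
theorem gInvariant_levi_decomposition
    (F : Type*) [Field F] [IsAlgClosed F] [CharZero F]
    (L : Type*) [LieRing L] [LieAlgebra F L] [Module.Finite F L]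
    (𝔤 : Type*) [LieRing 𝔤] [LieAlgebra F 𝔤] [Module.Finite F 𝔤] [LieAlgebra.IsSemisimple F 𝔤]
    -- `𝔤` acts on `L` by derivations
    (ρ : 𝔤 →ₗ⁅F⁆ LieDerivation F L L) :
    ∃ B : LieSubalgebra F L,
      -- `B` is a maximal semisimple subalgebra
      LieAlgebra.IsSemisimple F B ∧
      (∀ B' : LieSubalgebra F L, B ≤ B' → LieAlgebra.IsSemisimple F B' → B' = B) ∧
      -- `B` is a `𝔤`-submodule
      (∀ x : 𝔤, ∀ b ∈ B, ρ x b ∈ B) ∧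
      -- `L = B ⊕ R` as vector spaces, `R` the solvable radical
      IsCompl B.toSubmodule (LieAlgebra.radical F L).toSubmodule := by
  obtain ⟨B, h1, h2, h3, h4⟩ := GLevi.main ρ
  exact ⟨B, inferInstance, fun B' hB hs => h2 B' hB inferInstance, h3, h4⟩
end
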